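/- Let n ≥ 2 and d ≥ 2. If A is a homogeneous polynomial of degree d with real coefficients in the variables x_1,…,x_n such that A has at least one negative coefficient while the product A·S_n is coefficientwise nonnegative, then the number of monomials appearing in A·S_n satisfies |supp(A·S_n)| ≥ 3n − 4. -/

import Mathlib

open MvPolynomial
open Finsupp (single)

section LinearForm

variable {σ : Type*} [DecidableEq σ]

/-- The sum of the variables indexed by a finite set. -/
noncomputable def sumVars (I : Finset σ) : MvPolynomial σ ℝ := ∑ i ∈ I, X i

theorem coeff_mul_sumVars (A : MvPolynomial σ ℝ) (I : Finset σ) (b : σ →₀ ℕ) :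
    coeff b (A * sumVars I) =
      ∑ j ∈ I, if b j = 0 then 0 else coeff (b - single j 1) A := by
  rw [sumVars, Finset.mul_sum, coeff_sum]
  refine Finset.sum_congr rfl fun j _ => ?_
  rw [coeff_mul_X']
  by_cases h : b j = 0 <;> simp [h]

/-- The sum of the terms of a polynomial whose exponents satisfy a predicate. -/
noncomputable def termsWith (P : (σ →₀ ℕ) → Prop) [DecidablePred P] (A : MvPolynomial σ ℝ) :
    MvPolynomial σ ℝ :=
  ∑ m ∈ A.support.filter P, monomial m (coeff m A)

theorem coeff_termsWith (P : (σ →₀ ℕ) → Prop) [DecidablePred P] (A : MvPolynomial σ ℝ)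
    (m : σ →₀ ℕ) : coeff m (termsWith P A) = if P m then coeff m A else 0 := by
  classical
  rw [termsWith, coeff_sum]
  simp only [coeff_monomial]
  rw [Finset.sum_ite_eq']
  by_cases hP : P m <;> by_cases h : coeff m A = 0 <;> simp [hP, h]

theorem card_le_card_support_mul_sumVars {A : MvPolynomial σ ℝ} (hA : A ≠ 0) (I : Finset σ) :
    I.card ≤ (A * sumVars I).support.card := by
  have hne : A.support.Nonempty := support_nonempty.2 hA
  have hmax : ∀ i, ∃ v ∈ A.support, ∀ w ∈ A.support, w i ≤ v i := fun i =>
    Finset.exists_max_image A.support (fun v => v i) hne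
  choose v hv hmax using hmax
  refine Finset.card_le_card_of_injOn (fun i => v i + single i 1) ?_ ?_
  · intro i hi
    rw [Finset.mem_coe, mem_support_iff, coeff_mul_sumVars, Finset.sum_eq_single_of_mem i hi]
    · have := mem_support_iff.1 (hv i)
      simpa using this
    · intro j _ hj
      split_ifs with h
      · rfl
      · by_contra hc
        have := hmax i _ (mem_support_iff.2 hc)
        simp [hj] at this
  · intro i _ j _ hij
    by_contra hne
    have h1 := DFunLike.congr_fun hij i
    have h2 := hmax i _ (hv j)
    simp [Ne.symm hne] at h1
    omega

/-- The shifts of an exponent by the unit vectors indexed by `I` with `i` removed. -/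
noncomputable def shifts (I : Finset σ) (a : σ →₀ ℕ) (i : σ) : Finset (σ →₀ ℕ) :=
  (I.erase i).image fun k => a + single k 1

theorem mem_shifts {I : Finset σ} {a b : σ →₀ ℕ} {i : σ} :
    b ∈ shifts I a i ↔ ∃ k ∈ I, k ≠ i ∧ a + single k 1 = b := by
  simp only [shifts, Finset.mem_image, Finset.mem_erase]
  constructor
  · rintro ⟨k, ⟨h1, h2⟩, h3⟩
    exact ⟨k, h2, h1, h3⟩
  · rintro ⟨k, h2, h1, h3⟩
    exact ⟨k, ⟨h1, h2⟩, h3⟩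

theorem card_shifts {I : Finset σ} (a : σ →₀ ℕ) {i : σ} (hi : i ∈ I) :
    (shifts I a i).card = I.card - 1 := by
  rw [shifts, Finset.card_image_of_injective, Finset.card_erase_of_mem hi]
  intro k l h
  exact Finsupp.single_left_injective one_ne_zero (add_left_cancel h)

theorem card_shifts_inter_le_one (I : Finset σ) {a a' : σ →₀ ℕ} (h : a ≠ a') (i i' : σ) :
    (shifts I a i ∩ shifts I a' i').card ≤ 1 := by
  rw [Finset.card_le_one]
  intro b hb c hc
  simp only [Finset.mem_inter, mem_shifts] at hb hc
  obtain ⟨⟨k, -, -, rfl⟩, k', -, -, hk⟩ := hb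
  obtain ⟨⟨l, -, -, rfl⟩, l', -, -, hl⟩ := hc
  have hkk : k ≠ k' := by
    rintro rfl
    exact h (add_right_cancel hk).symm
  by_cases hkl : k = l
  · rw [hkl]
  · have h1 := DFunLike.congr_fun hk k
    have h2 := DFunLike.congr_fun hl k
    simp [Finsupp.single_apply, hkk.symm, Ne.symm hkl] at h1 h2
    omega

theorem disjoint_shifts {I : Finset σ} {a a' : σ →₀ ℕ} {i i' : σ} (hi' : i' ∈ I)
    (ha : ∀ j ∈ I, a j = 0 → j = i) (ha' : a' i' = 0) (hii : i' ≠ i) :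
    Disjoint (shifts I a i) (shifts I a' i') := by
  rw [Finset.disjoint_left]
  intro b hb hb'
  rw [mem_shifts] at hb hb'
  obtain ⟨k, -, -, rfl⟩ := hb
  obtain ⟨l, -, hl, h⟩ := hb'
  have := DFunLike.congr_fun h i'
  have h3 := ha i' hi'
  simp [Finsupp.single_apply, hl, ha'] at this
  exact hii (h3 (by omega))

/-- Three families of shifts, the first disjoint from the two others. -/
theorem card_ge_of_shifts {I : Finset σ} {B F G H : Finset (σ →₀ ℕ)} (hF : F ⊆ B) (hG : G ⊆ B)
    (hH : H ⊆ B) (cF : F.card = I.card - 1) (cG : G.card = I.card - 1) (cH : H.card = I.card - 1)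
    (hFG : Disjoint F G) (hFH : Disjoint F H) (hGH : (G ∩ H).card ≤ 1) :
    3 * I.card ≤ B.card + 4 := by
  have h1 := Finset.card_union_of_disjoint (Finset.disjoint_union_right.2 ⟨hFG, hFH⟩)
  have h2 := Finset.card_union_add_card_inter G H
  have h3 := Finset.card_le_card (Finset.union_subset hF (Finset.union_subset hG hH))
  omega

section Boundary

variable {I : Finset σ} {A : MvPolynomial σ ℝ}

theorem shifts_subset_support (hneg : ∀ m, coeff m A < 0 → ∀ i ∈ I, m i ≠ 0)
    {a : σ →₀ ℕ} (ha : a ∈ A.support) {i : σ} (hi : i ∈ I) (hai : a i = 0) :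
    shifts I a i ⊆ (A * sumVars I).support := by
  have hnn : ∀ m : σ →₀ ℕ, m i = 0 → 0 ≤ coeff m A := fun m hm => by
    by_contra! h
    exact hneg m h i hi hm
  intro b hb
  obtain ⟨k, hk, hki, rfl⟩ := mem_shifts.1 hb
  rw [mem_support_iff, coeff_mul_sumVars]
  refine (Finset.sum_pos' (fun j _ => ?_) ⟨k, hk, ?_⟩).ne'
  · split_ifs with h
    · exact le_rfl
    · apply hnn
      simp [Finsupp.single_apply, hki, hai]
  · have := lt_of_le_of_ne (hnn a hai) (mem_support_iff.1 ha).symm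
    simpa using this

/-- At an exponent positive on `I`, only the terms of `A` lying on a facet of the orthant
distinguish `A * sumVars I` from its interior analogue. -/
theorem coeff_mul_eq_of_interior {b : σ →₀ ℕ} (hb : ∀ i ∈ I, b i ≠ 0)
    (h : ∀ j ∈ I, b - single j 1 ∈ A.support → b j ≠ 1) :
    coeff b (termsWith (fun m => ∀ i ∈ I, m i ≠ 0) A * sumVars I) =
      coeff b (A * sumVars I) := by
  rw [coeff_mul_sumVars, coeff_mul_sumVars]
  refine Finset.sum_congr rfl fun j hj => ?_
  rw [coeff_termsWith]
  split_ifs with h1 h2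
  · rfl
  · rfl
  · by_contra hc
    have h3 := h j hj (mem_support_iff.2 (Ne.symm hc))
    apply h2
    intro i hi
    have := hb i hi
    simp only [Finsupp.coe_tsub, Pi.sub_apply, Finsupp.single_apply]
    split_ifs with hij
    · subst hij; omega
    · omega

theorem interior_of_coeff_ne_zero {b : σ →₀ ℕ}
    (h : coeff b (termsWith (fun m => ∀ i ∈ I, m i ≠ 0) A * sumVars I) ≠ 0) :
    ∀ i ∈ I, b i ≠ 0 := by
  intro i hi hbi
  apply h
  rw [coeff_mul_sumVars]
  refine Finset.sum_eq_zero fun j _ => ?_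
  split_ifs with h1
  · rfl
  · rw [coeff_termsWith, if_neg]
    intro h2
    apply h2 i hi
    simp [hbi]

/-- A term of `A` lying on exactly one facet, when all terms on facets are nonnegative. -/
theorem card_of_facet_term (hI : 3 ≤ I.card) (hneg : ∀ m, coeff m A < 0 → ∀ i ∈ I, m i ≠ 0)
    (hex : ∃ m, coeff m A < 0) (hzero : ∀ i ∈ I, ∃ m ∈ A.support, m i = 0)
    {a : σ →₀ ℕ} (ha : a ∈ A.support) {p : σ} (hp : p ∈ I) (hap : a p = 0)
    (hau : ∀ j ∈ I, a j = 0 → j = p) :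
    3 * I.card ≤ (A * sumVars I).support.card + 4 := by
  have hsub := fun {a} (ha : a ∈ A.support) {i} (hi : i ∈ I) (hai : a i = 0) =>
    shifts_subset_support hneg ha hi hai
  by_cases hdist : ∃ q ∈ I, ∃ r ∈ I, q ≠ p ∧ r ≠ p ∧ ∃ a₂ ∈ A.support, ∃ a₃ ∈ A.support,
      a₂ q = 0 ∧ a₃ r = 0 ∧ a₂ ≠ a₃
  · obtain ⟨q, hq, r, hr, hqp, hrp, a₂, ha₂, a₃, ha₃, h2, h3, hne⟩ := hdist
    exact card_ge_of_shifts (hsub ha hp hap) (hsub ha₂ hq h2) (hsub ha₃ hr h3)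
      (card_shifts _ hp) (card_shifts _ hq) (card_shifts _ hr)
      (disjoint_shifts hq hau h2 hqp) (disjoint_shifts hr hau h3 hrp)
      (card_shifts_inter_le_one I hne q r)
  push Not at hdist
  obtain ⟨q, hq, r, hr, hqr⟩ : ∃ q ∈ I.erase p, ∃ r ∈ I.erase p, q ≠ r :=
    Finset.one_lt_card.1 (by rw [Finset.card_erase_of_mem hp]; omega)
  rw [Finset.mem_erase] at hq hr
  obtain ⟨c, hc, hcq⟩ := hzero q hq.2
  have hcuniq : ∀ j ∈ I, j ≠ p → ∀ m ∈ A.support, m j = 0 → m = c := fun j hj hjp m hm hmj =>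
    hdist j hj q hq.2 hjp hq.1 m hm c hc hmj hcq
  have hczero : ∀ j ∈ I, j ≠ p → c j = 0 := fun j hj hjp => by
    obtain ⟨m, hm, hmj⟩ := hzero j hj
    rwa [← hcuniq j hj hjp m hm hmj]
  have hdisj : ∀ a' : σ →₀ ℕ, (∀ j ∈ I, a' j = 0 → j = p) →
      Disjoint (shifts I c q) (shifts I a' p) := fun a' h =>
    (disjoint_shifts hq.2 h hcq hq.1).symm
  by_cases htwo : ∃ a' ∈ A.support, a' p = 0 ∧ (∀ j ∈ I, a' j = 0 → j = p) ∧ a' ≠ a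
  · obtain ⟨a', ha', ha'p, ha'u, hne⟩ := htwo
    exact card_ge_of_shifts (hsub hc hq.2 hcq) (hsub ha' hp ha'p) (hsub ha hp hap)
      (card_shifts _ hq.2) (card_shifts _ hp) (card_shifts _ hp)
      (hdisj a' ha'u) (hdisj a hau) (card_shifts_inter_le_one I hne p p)
  push Not at htwo
  set A' := termsWith (fun m => ∀ i ∈ I, m i ≠ 0) A with hA'
  have hA'0 : A' ≠ 0 := by
    obtain ⟨m, hm⟩ := hex
    intro h0
    have := coeff_termsWith (fun m => ∀ i ∈ I, m i ≠ 0) A m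
    rw [← hA', h0, coeff_zero, if_pos (hneg m hm)] at this
    exact hm.ne this.symm
  have hcard := card_le_card_support_mul_sumVars hA'0 I
  set E := (A' * sumVars I).support.erase (a + single p 1) with hE
  have hEint : ∀ b ∈ E, ∀ i ∈ I, b i ≠ 0 := fun b hb =>
    interior_of_coeff_ne_zero (mem_support_iff.1 (Finset.mem_of_mem_erase hb))
  have hEsub : E ⊆ (A * sumVars I).support := by
    intro b hb
    have hbi := hEint b hb
    have hb' := Finset.mem_erase.1 hb
    rw [mem_support_iff, ← coeff_mul_eq_of_interior hbi]
    · exact mem_support_iff.1 hb'.2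
    · intro j hj hjs hbj
      have hj0 : (b - single j 1 : σ →₀ ℕ) j = 0 := by simp [hbj]
      have hjn : ∀ i ∈ I, (b - single j 1 : σ →₀ ℕ) i = 0 → i = j := by
        intro i hi h
        by_contra hij
        apply hbi i hi
        simpa [Finsupp.single_apply, Ne.symm hij] using h
      by_cases hjp : j = p
      · subst hjp
        apply hb'.1
        rw [← htwo _ hjs hj0 hjn]
        ext i
        by_cases hij : j = i
        · subst hij; simp [hbj]
        · simp [hij]
      · have h1 := hcuniq j hj hjp _ hjs hj0
        rw [h1] at hjn
        have h2 := hjn q hq.2 hcq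
        have h3 := hjn r hr.2 (hczero r hr.2 hr.1)
        exact hqr (h2.trans h3.symm)
  have hd1 : Disjoint E (shifts I c q) := by
    rw [Finset.disjoint_left]
    intro b hb hb'
    obtain ⟨k, -, hk, rfl⟩ := mem_shifts.1 hb'
    apply hEint _ hb q hq.2
    simp [hk, hcq]
  have hd2 : Disjoint E (shifts I a p) := by
    rw [Finset.disjoint_left]
    intro b hb hb'
    obtain ⟨k, -, hk, rfl⟩ := mem_shifts.1 hb'
    apply hEint _ hb p hp
    simp [hk, hap]
  have h1 := Finset.card_union_of_disjoint
    (Finset.disjoint_union_right.2 ⟨hd1, hd2⟩)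
  have h2 := Finset.card_union_of_disjoint (hdisj a hau)
  have h3 := Finset.card_le_card (Finset.union_subset hEsub
    (Finset.union_subset (hsub hc hq.2 hcq) (hsub ha hp hap)))
  have h4 := Finset.pred_card_le_card_erase (s := (A' * sumVars I).support)
    (a := a + single p 1)
  have h5 := card_shifts c hq.2
  have h6 := card_shifts a hp
  rw [← hE] at h4
  omega

end Boundary

theorem coeff_mul_nonneg {p q : MvPolynomial σ ℝ} (hp : ∀ m, 0 ≤ coeff m p)
    (hq : ∀ m, 0 ≤ coeff m q) (m : σ →₀ ℕ) : 0 ≤ coeff m (p * q) := by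
  rw [coeff_mul]
  exact Finset.sum_nonneg fun x _ => mul_nonneg (hp _) (hq _)

theorem coeff_monomial_nonneg {s : σ →₀ ℕ} {a : ℝ} (ha : 0 ≤ a) (m : σ →₀ ℕ) :
    0 ≤ coeff m (monomial s a) := by
  rw [coeff_monomial]
  split_ifs <;> simp [ha]

theorem coeff_sumVars_nonneg (I : Finset σ) (m : σ →₀ ℕ) : 0 ≤ coeff m (sumVars I) := by
  rw [sumVars, coeff_sum]
  exact Finset.sum_nonneg fun i _ => coeff_monomial_nonneg zero_le_one m

theorem coeff_sumVars_pow_nonneg (I : Finset σ) (k : ℕ) (m : σ →₀ ℕ) :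
    0 ≤ coeff m (sumVars I ^ k) := by
  induction k generalizing m with
  | zero => simpa using coeff_monomial_nonneg (s := 0) zero_le_one m
  | succ k ih =>
    rw [pow_succ]
    exact coeff_mul_nonneg ih (coeff_sumVars_nonneg I) m

theorem mem_finsuppAntidiag_iff_degree {I : Finset σ} {L : ℕ} {v : σ →₀ ℕ} :
    v ∈ I.finsuppAntidiag L ↔ v.degree = L ∧ v.support ⊆ I := by
  rw [Finset.mem_finsuppAntidiag']
  rfl

theorem add_single_mem {I : Finset σ} {L : ℕ} {v : σ →₀ ℕ} (hv : v ∈ I.finsuppAntidiag L) {j : σ}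
    (hj : j ∈ I) : v + single j 1 ∈ I.finsuppAntidiag (L + 1) := by
  rw [mem_finsuppAntidiag_iff_degree] at hv ⊢
  refine ⟨by rw [map_add, hv.1, Finsupp.degree_single], ?_⟩
  exact Finsupp.support_add.trans (Finset.union_subset hv.2
    (Finsupp.support_single_subset.trans (Finset.singleton_subset_iff.2 hj)))

omit [DecidableEq σ] in
theorem sub_single_add {v : σ →₀ ℕ} {j : σ} (h : v j ≠ 0) : v - single j 1 + single j 1 = v :=
  tsub_add_cancel_of_le (Finsupp.single_le_iff.2 (Nat.one_le_iff_ne_zero.2 h))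

theorem sub_single_mem {I : Finset σ} {L : ℕ} {v : σ →₀ ℕ} (hv : v ∈ I.finsuppAntidiag (L + 1))
    {j : σ} (hj : v j ≠ 0) : v - single j 1 ∈ I.finsuppAntidiag L := by
  rw [mem_finsuppAntidiag_iff_degree] at hv ⊢
  refine ⟨?_, Finsupp.support_tsub.trans hv.2⟩
  have := congrArg Finsupp.degree (sub_single_add hj)
  rw [map_add, Finsupp.degree_single, hv.1] at this
  omega

theorem support_sumVars_pow (I : Finset σ) (L : ℕ) :
    (sumVars I ^ L).support = I.finsuppAntidiag L := by
  induction L with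
  | zero => simp
  | succ L ih =>
    ext v
    rw [mem_support_iff, pow_succ, coeff_mul_sumVars]
    constructor
    · intro h
      obtain ⟨j, hj, h⟩ := Finset.exists_ne_zero_of_sum_ne_zero h
      split_ifs at h with hvj
      · exact absurd rfl h
      · rw [← mem_support_iff, ih] at h
        rw [← sub_single_add hvj]
        exact add_single_mem h hj
    · intro hv
      have hv' := Finset.mem_finsuppAntidiag.1 hv
      obtain ⟨j, hj, hvj⟩ := Finset.exists_ne_zero_of_sum_ne_zero (hv'.1.trans_ne L.succ_ne_zero)
      refine (Finset.sum_pos' (fun i _ => ?_) ⟨j, hj, ?_⟩).ne'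
      · split_ifs
        · exact le_rfl
        · exact coeff_sumVars_pow_nonneg _ _ _
      · rw [if_neg hvj]
        refine lt_of_le_of_ne (coeff_sumVars_pow_nonneg _ _ _) (Ne.symm ?_)
        rw [← mem_support_iff, ih]
        exact sub_single_mem hv hvj

theorem coeff_sumVars_pow_pos {I : Finset σ} {L : ℕ} {v : σ →₀ ℕ}
    (hv : v ∈ I.finsuppAntidiag L) : 0 < coeff v (sumVars I ^ L) := by
  refine lt_of_le_of_ne (coeff_sumVars_pow_nonneg _ _ _) (Ne.symm ?_)
  rwa [← mem_support_iff, support_sumVars_pow]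

theorem coeff_single_sumVars_pow {I : Finset σ} {p : σ} (hp : p ∈ I) (L : ℕ) :
    coeff (single p L) (sumVars I ^ L) = 1 := by
  induction L with
  | zero => simp
  | succ L ih =>
    rw [pow_succ, coeff_mul_sumVars, Finset.sum_eq_single_of_mem p hp]
    · simp [ih]
    · intro j _ hj
      simp [hj.symm]

theorem single_mem {I : Finset σ} {p : σ} (hp : p ∈ I) (L : ℕ) :
    single p L ∈ I.finsuppAntidiag L := by
  rw [mem_finsuppAntidiag_iff_degree]
  exact ⟨Finsupp.degree_single _ _,
    Finsupp.support_single_subset.trans (Finset.singleton_subset_iff.2 hp)⟩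

theorem card_finsuppAntidiag_add_le {I : Finset σ} (hI : I.Nonempty) (L r : ℕ) :
    (I.finsuppAntidiag L).card + r * (I.card - 1) ≤ (I.finsuppAntidiag (L + r)).card := by
  induction r with
  | zero => simp
  | succ r ih =>
    obtain ⟨i, hi⟩ := hI
    have h1 : (I.finsuppAntidiag (L + r)).image (fun v => v + single i 1) ∪
        (I.erase i).image (fun j => single j (L + r + 1)) ⊆ I.finsuppAntidiag (L + r + 1) := by
      apply Finset.union_subset
      · intro v hv
        obtain ⟨w, hw, rfl⟩ := Finset.mem_image.1 hv
        exact add_single_mem hw hi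
      · intro v hv
        obtain ⟨j, hj, rfl⟩ := Finset.mem_image.1 hv
        exact single_mem (Finset.mem_of_mem_erase hj) _
    have h2 := Finset.card_le_card h1
    rw [Finset.card_union_of_disjoint, Finset.card_image_of_injective,
      Finset.card_image_of_injective, Finset.card_erase_of_mem hi] at h2
    · rw [← add_assoc, Nat.succ_mul]
      omega
    · exact Finsupp.single_left_injective (Nat.succ_ne_zero _)
    · exact fun a b h => add_right_cancel h
    · rw [Finset.disjoint_left]
      intro v hv hv'
      obtain ⟨w, -, rfl⟩ := Finset.mem_image.1 hv
      obtain ⟨j, hj, h⟩ := Finset.mem_image.1 hv'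
      have := DFunLike.congr_fun h i
      simp [(Finset.ne_of_mem_erase hj)] at this

theorem card_not_le_ge {I : Finset σ} (hI : I.Nonempty) (L : ℕ) (e : σ →₀ ℕ) :
    e.degree * (I.card - 1) ≤
      ((I.finsuppAntidiag (L + e.degree)).filter fun v => ¬ e ≤ v).card := by
  have h1 := card_finsuppAntidiag_add_le hI L e.degree
  have h2 := Finset.card_filter_add_card_filter_not (s := I.finsuppAntidiag (L + e.degree))
    (fun v => e ≤ v)
  have h3 : ((I.finsuppAntidiag (L + e.degree)).filter fun v => e ≤ v).card ≤
      (I.finsuppAntidiag L).card := by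
    refine Finset.card_le_card_of_injOn (fun v => v - e) ?_ ?_
    · intro v hv
      rw [Finset.mem_coe, Finset.mem_filter, mem_finsuppAntidiag_iff_degree] at hv
      rw [Finset.mem_coe, mem_finsuppAntidiag_iff_degree]
      refine ⟨?_, Finsupp.support_tsub.trans hv.1.2⟩
      have := congrArg Finsupp.degree (tsub_add_cancel_of_le hv.2)
      rw [map_add, hv.1.1] at this
      exact Nat.add_right_cancel this
    · intro v hv w hw h
      rw [Finset.mem_coe, Finset.mem_filter] at hv hw
      rw [← tsub_add_cancel_of_le hv.2, ← tsub_add_cancel_of_le hw.2]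
      exact congrArg (· + e) h
  omega

theorem card_support_of_sub {I : Finset σ} (hI : 2 ≤ I.card) {c c' : ℝ} (hc : 0 < c)
    (hc' : 0 < c') {s t : σ →₀ ℕ} {l k : ℕ} (hdeg : s.degree + l = t.degree + k)
    (ht : t.support ⊆ I) (hl : Even l) (hk : Odd k) {A : MvPolynomial σ ℝ}
    (hA : A = monomial s c * sumVars I ^ l - monomial t c' * sumVars I ^ k)
    (hpos : ∀ m, 0 ≤ coeff m (A * sumVars I)) (hneg : ∃ m, coeff m A < 0) :
    3 * (I.card - 1) ≤ (A * sumVars I).support.card := by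
  have hAS : A * sumVars I =
      monomial s c * sumVars I ^ (l + 1) - monomial t c' * sumVars I ^ (k + 1) := by
    rw [hA]; ring
  have hle : ∀ v ∈ I.finsuppAntidiag (k + 1), s ≤ t + v := by
    intro v hv
    by_contra h
    have h1 := hpos (t + v)
    rw [hAS, coeff_sub, coeff_monomial_mul, coeff_monomial_mul', if_neg h] at h1
    have h2 := mul_pos hc' (coeff_sumVars_pow_pos hv)
    linarith
  have hst : s ≤ t := by
    intro i
    obtain ⟨j, hj, hji⟩ := Finset.exists_mem_ne (by omega : 1 < I.card) i
    have := hle _ (single_mem hj _) i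
    simpa [Finsupp.single_apply, hji] using this
  obtain ⟨e, rfl⟩ := exists_add_of_le hst
  have heI : e.support ⊆ I := fun i hi => ht (by
    rw [Finsupp.mem_support_iff] at hi ⊢
    simp [hi])
  have hl' : l = k + e.degree := by
    rw [map_add] at hdeg
    omega
  have hodd : Odd e.degree := by
    subst hl'
    by_contra h
    rw [Nat.not_odd_iff_even] at h
    exact (Nat.not_even_iff_odd.2 (hk.add_even h)) hl
  have hcoeff : ∀ v, coeff (s + v) (A * sumVars I) = c * coeff v (sumVars I ^ (l + 1)) -
      if e ≤ v then c' * coeff (v - e) (sumVars I ^ (k + 1)) else 0 := by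
    intro v
    rw [hAS, coeff_sub, coeff_monomial_mul, coeff_monomial_mul']
    simp only [add_le_add_iff_left, add_tsub_add_eq_tsub_left]
  have hr : e.degree = 1 ∨ 3 ≤ e.degree := by
    obtain ⟨a, ha⟩ := hodd
    omega
  rcases hr with hr | hr
  · exfalso
    obtain ⟨p, rfl⟩ := (Finsupp.sum_eq_one_iff e).1 hr
    have hp : p ∈ I := heI (by simp)
    have h1 : c' ≤ c := by
      have := hcoeff (single p (k + 2))
      rw [hl', hr, coeff_single_sumVars_pow hp, if_pos (by simp), ← Finsupp.single_tsub] at this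
      have h2 := coeff_single_sumVars_pow hp (k + 1)
      have h3 := hpos (s + single p (k + 2))
      rw [this, show k + 2 - 1 = k + 1 by omega, h2] at h3
      linarith
    have hsum : sumVars I = X p + sumVars (I.erase p) :=
      (Finset.add_sum_erase I (fun i => (X i : MvPolynomial σ ℝ)) hp).symm
    have hfac : A = monomial s 1 * sumVars I ^ k *
        (monomial (single p 1) (c - c') + monomial 0 c * sumVars (I.erase p)) := by
      have e1 : (monomial s c : MvPolynomial σ ℝ) = monomial s 1 * C c := by
        rw [mul_comm, C_mul_monomial, mul_one]
      have e2 : (monomial (s + single p 1) c' : MvPolynomial σ ℝ) = monomial s 1 * C c' * X p := by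
        rw [mul_comm (monomial s 1), C_mul_monomial, mul_one, X, monomial_mul, mul_one]
      have e3 : (monomial (single p 1) (c - c') : MvPolynomial σ ℝ) = (C c - C c') * X p := by
        rw [X, ← C_sub, C_mul_monomial, mul_one]
      have e4 : (monomial 0 c : MvPolynomial σ ℝ) = C c := rfl
      rw [hA, hl', hr, pow_succ, e1, e2, e3, e4]
      have e5 : sumVars (I.erase p) = sumVars I - X p := by rw [hsum]; ring
      rw [e5]
      ring
    obtain ⟨m, hm⟩ := hneg
    refine hm.not_ge ?_
    rw [hfac]
    refine coeff_mul_nonneg (coeff_mul_nonneg (coeff_monomial_nonneg zero_le_one)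
      (coeff_sumVars_pow_nonneg I k)) (fun m => ?_) m
    rw [coeff_add]
    exact add_nonneg (coeff_monomial_nonneg (sub_nonneg.2 h1) m)
      (coeff_mul_nonneg (coeff_monomial_nonneg hc.le) (coeff_sumVars_nonneg _) m)
  · calc 3 * (I.card - 1) ≤ e.degree * (I.card - 1) := Nat.mul_le_mul_right _ hr
      _ ≤ _ := card_not_le_ge (Finset.card_pos.1 (by omega)) (k + 1) e
      _ ≤ _ := Finset.card_le_card_of_injOn (fun v => s + v) (fun v hv => ?_)
        (fun v _ w _ h => add_left_cancel h)
    rw [Finset.mem_coe, Finset.mem_filter] at hv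
    rw [Finset.mem_coe, mem_support_iff, hcoeff, if_neg hv.2, sub_zero]
    have : l + 1 = k + 1 + e.degree := by omega
    rw [this]
    exact (mul_pos hc (coeff_sumVars_pow_pos hv.1)).ne'

theorem eq_zero_of_neg {I : Finset σ} (hI : 0 < I.card) {P : MvPolynomial σ ℝ}
    (hP : ∀ m, 0 ≤ coeff m P) (h : ∀ m, 0 ≤ coeff m (-P * sumVars I)) : P = 0 := by
  by_contra h0
  have h1 : P * sumVars I = 0 := by
    ext m
    have h2 := coeff_mul_nonneg hP (coeff_sumVars_nonneg I) m
    have h3 := h m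
    rw [neg_mul, coeff_neg] at h3
    rw [coeff_zero]
    linarith
  have := card_le_card_support_mul_sumVars h0 I
  rw [h1, support_zero, Finset.card_empty] at this
  omega

/-- Elimination of the variable `i` by means of the relation `sumVars I = 0`. -/
theorem aeval_neg_sumVars_monomial (I : Finset σ) (i : σ) (m : σ →₀ ℕ) (a : ℝ) :
    aeval (fun j => if j = i then -sumVars I else X j) (monomial m a) =
      monomial (m.erase i) a * (-sumVars I) ^ m i := by
  rw [aeval_monomial, ← Finsupp.mul_prod_erase' m i _ (fun _ => pow_zero _), if_pos rfl,
    monomial_eq (s := m.erase i)]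
  have : ((m.erase i).prod fun j k => (if j = i then -sumVars I else X j) ^ k) =
      (m.erase i).prod fun j k => (X j : MvPolynomial σ ℝ) ^ k := by
    refine Finsupp.prod_congr fun j hj => ?_
    rw [if_neg]
    rintro rfl
    simp at hj
  rw [this, algebraMap_eq]
  ring

theorem card_of_neg_on_facet {I : Finset σ} (hI : 3 ≤ I.card) {i : σ} (hi : i ∈ I) {d : ℕ}
    {A : MvPolynomial σ ℝ} (hA : ∀ m ∈ A.support, m.degree = d ∧ m.support ⊆ I)
    (hpos : ∀ m, 0 ≤ coeff m (A * sumVars I)) (hneg : ∃ m, coeff m A < 0 ∧ m i = 0)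
    (hrec : ∀ A₀ : MvPolynomial σ ℝ, (∀ m ∈ A₀.support, m.degree = d ∧ m.support ⊆ I.erase i) →
      (∀ m, 0 ≤ coeff m (A₀ * sumVars (I.erase i))) → (∃ m, coeff m A₀ < 0) →
      3 * (I.erase i).card ≤ (A₀ * sumVars (I.erase i)).support.card + 4) :
    3 * I.card ≤ (A * sumVars I).support.card + 4 := by
  set I' := I.erase i with hI'
  have hcard' : I'.card = I.card - 1 := Finset.card_erase_of_mem hi
  set A₀ := termsWith (fun m => m i = 0) A with hA₀
  have hc₀ : ∀ m, coeff m A₀ = if m i = 0 then coeff m A else 0 := coeff_termsWith _ A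
  set R := A.divMonomial (single i 1) with hR
  have hsplit : A = X i * R + A₀ := by
    ext m
    rw [coeff_add, coeff_X_mul', hc₀, hR, coeff_divMonomial]
    by_cases h : m i = 0
    · simp [h]
    · rw [if_pos (Finsupp.mem_support_iff.2 h), if_neg h, add_comm (single i 1),
        sub_single_add h, add_zero]
  have hsum : sumVars I = X i + sumVars I' :=
    (Finset.add_sum_erase I (fun i => (X i : MvPolynomial σ ℝ)) hi).symm
  set D := A₀ + R * sumVars I with hD
  have hAS : A * sumVars I = A₀ * sumVars I' + X i * D := by
    rw [hD, hsplit, hsum]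
    ring
  have hz : ∀ m : σ →₀ ℕ, m i ≠ 0 → coeff m (A₀ * sumVars I') = 0 := by
    intro m hm
    rw [coeff_mul_sumVars]
    refine Finset.sum_eq_zero fun j hj => ?_
    rw [hc₀]
    split_ifs with h1 h2
    · rfl
    · simp [Finset.ne_of_mem_erase hj, hm] at h2
    · rfl
  have hlow : ∀ m : σ →₀ ℕ, m i = 0 → coeff m (A * sumVars I) = coeff m (A₀ * sumVars I') := by
    intro m hm
    rw [hAS, coeff_add, coeff_X_mul', if_neg (by simpa using hm), add_zero]
  have hhigh : ∀ m, coeff (m + single i 1) (A * sumVars I) = coeff m D := by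
    intro m
    rw [hAS, coeff_add, hz _ (by simp), zero_add, add_comm, coeff_X_mul]
  have hpos₀ : ∀ m, 0 ≤ coeff m (A₀ * sumVars I') := by
    intro m
    by_cases hm : m i = 0
    · rw [← hlow m hm]; exact hpos m
    · rw [hz m hm]
  have hneg₀ : ∃ m, coeff m A₀ < 0 := by
    obtain ⟨m, hm, hmi⟩ := hneg
    exact ⟨m, by rwa [hc₀, if_pos hmi]⟩
  have hA₀s : ∀ m ∈ A₀.support, m.degree = d ∧ m.support ⊆ I' := by
    intro m hm
    rw [mem_support_iff, hc₀] at hm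
    split_ifs at hm with h
    · obtain ⟨h1, h2⟩ := hA m (mem_support_iff.2 hm)
      exact ⟨h1, Finset.subset_erase.2 ⟨h2, by simpa using h⟩⟩
    · exact absurd rfl hm
  have hrec₀ := hrec A₀ hA₀s hpos₀ hneg₀
  have hcount : (A₀ * sumVars I').support.card + D.support.card ≤
      (A * sumVars I).support.card := by
    rw [← Finset.card_image_of_injective D.support (add_left_injective (single i 1)),
      ← Finset.card_union_of_disjoint]
    · apply Finset.card_le_card
      apply Finset.union_subset
      · intro m hm
        rw [mem_support_iff] at hm ⊢
        rwa [hlow]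
        by_contra h
        exact hm (hz m h)
      · intro m hm
        obtain ⟨w, hw, rfl⟩ := Finset.mem_image.1 hm
        rw [mem_support_iff] at hw ⊢
        rwa [hhigh]
    · rw [Finset.disjoint_left]
      intro m hm hm'
      obtain ⟨w, -, rfl⟩ := Finset.mem_image.1 hm'
      exact mem_support_iff.1 hm (hz _ (by simp))
  have hDnn : ∀ m, 0 ≤ coeff m D := fun m => by rw [← hhigh]; exact hpos _
  have hDs : ∀ m ∈ D.support, m.degree = d ∧ m.support ⊆ I := by
    intro m hm
    rw [mem_support_iff, ← hhigh, coeff_mul_sumVars] at hm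
    obtain ⟨j, hj, h⟩ := Finset.exists_ne_zero_of_sum_ne_zero hm
    split_ifs at h with hmj
    · exact absurd rfl h
    · have hs := sub_single_add hmj
      obtain ⟨h1, h2⟩ := hA _ (mem_support_iff.2 h)
      constructor
      · have := congrArg Finsupp.degree hs
        rw [map_add, map_add, Finsupp.degree_single, Finsupp.degree_single, h1] at this
        omega
      · intro x hx
        by_cases hxj : x = j
        · rwa [hxj]
        · apply h2
          rw [Finsupp.mem_support_iff] at hx ⊢
          simp [Finsupp.single_apply, Ne.symm hxj, hx]
  set φ : MvPolynomial σ ℝ →ₐ[ℝ] MvPolynomial σ ℝ :=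
    aeval (fun j => if j = i then -sumVars I' else X j) with hφ
  have hφS : φ (sumVars I) = 0 := by
    rw [hsum, map_add, hφ, aeval_X, if_pos rfl, neg_add_eq_zero]
    simp only [sumVars, map_sum, aeval_X]
    refine Finset.sum_congr rfl fun j hj => ?_
    rw [if_neg (Finset.ne_of_mem_erase hj)]
  have hφA : φ A₀ = A₀ := by
    conv_rhs => rw [hA₀]
    rw [hA₀, termsWith, map_sum]
    refine Finset.sum_congr rfl fun m hm => ?_
    have hmi : m i = 0 := (Finset.mem_filter.1 hm).2
    rw [hφ, aeval_neg_sumVars_monomial, hmi, pow_zero, mul_one,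
      Finsupp.erase_of_notMem_support (by simpa using hmi)]
  have hφD : A₀ = φ D := by
    rw [hD, map_add, map_mul, hφS, mul_zero, add_zero, hφA]
  have hφm : ∀ s a, φ (monomial s a) = monomial (s.erase i) a * (-sumVars I') ^ s i :=
    aeval_neg_sumVars_monomial I' i
  have hterm : ∀ (s : σ →₀ ℕ) (a : ℝ), 0 ≤ a → ∀ (k : ℕ) (m : σ →₀ ℕ),
      0 ≤ coeff m (monomial s a * sumVars I' ^ k) := fun s a ha k =>
    coeff_mul_nonneg (coeff_monomial_nonneg ha) (coeff_sumVars_pow_nonneg I' k)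
  have hsign : ¬ ∀ m, 0 ≤ coeff m A₀ := by
    obtain ⟨m, hm⟩ := hneg₀
    exact fun h => hm.not_ge (h m)
  have hsign' : ∀ P : MvPolynomial σ ℝ, (∀ m, 0 ≤ coeff m P) → A₀ ≠ -P := by
    intro P hP h
    have := eq_zero_of_neg (by omega : 0 < I'.card) hP (by rwa [← h])
    apply hsign
    simp [h, this]
  have hcases : D.support.card = 0 ∨ D.support.card = 1 ∨ D.support.card = 2 ∨
      3 ≤ D.support.card := by omega
  rcases hcases with h | h | h | h
  · exfalso
    rw [Finset.card_eq_zero, support_eq_empty] at h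
    rw [h, map_zero] at hφD
    exact hsign (by simp [hφD])
  · exfalso
    obtain ⟨s, hs⟩ := Finset.card_eq_one.1 h
    rw [D.as_sum, hs, Finset.sum_singleton, hφm] at hφD
    have hs := hterm (s.erase i) _ (hDnn s) (s i)
    rcases Nat.even_or_odd (s i) with hp | hp
    · rw [hp.neg_pow] at hφD
      exact hsign (by rwa [hφD])
    · rw [hp.neg_pow, mul_neg] at hφD
      exact hsign' _ hs hφD
  · have key : ∀ s ∈ D.support, ∀ t ∈ D.support, Even (s i) → Odd (t i) →
        A₀ = monomial (s.erase i) (coeff s D) * (-sumVars I') ^ s i +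
          monomial (t.erase i) (coeff t D) * (-sumVars I') ^ t i →
        3 * I.card ≤ (A * sumVars I).support.card + 4 := by
      intro s hs t ht hse hto hst
      rw [hse.neg_pow, hto.neg_pow, mul_neg, ← sub_eq_add_neg] at hst
      have hdeg : ∀ w ∈ D.support, (w.erase i).degree + w i = d := by
        intro w hw
        rw [← (hDs w hw).1]
        conv_rhs => rw [← Finsupp.erase_add_single i w, map_add, Finsupp.degree_single]
      have hp : ∀ w ∈ D.support, 0 < coeff w D := fun w hw =>
        lt_of_le_of_ne (hDnn w) (mem_support_iff.1 hw).symm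
      have := card_support_of_sub (by omega : 2 ≤ I'.card) (hp s hs) (hp t ht)
        ((hdeg s hs).trans (hdeg t ht).symm)
        (by rw [Finsupp.support_erase]; exact Finset.erase_subset_erase i (hDs t ht).2)
        hse hto hst hpos₀ hneg₀
      omega
    obtain ⟨s, t, hst, hD2⟩ := Finset.card_eq_two.1 h
    have hsD : s ∈ D.support := by simp [hD2]
    have htD : t ∈ D.support := by simp [hD2]
    rw [D.as_sum, hD2, Finset.sum_pair hst, map_add, hφm, hφm] at hφD
    have hs' := hterm (s.erase i) _ (hDnn s) (s i)
    have ht' := hterm (t.erase i) _ (hDnn t) (t i)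
    rcases Nat.even_or_odd (s i) with hp | hp <;> rcases Nat.even_or_odd (t i) with hq | hq
    · exfalso
      rw [hp.neg_pow, hq.neg_pow] at hφD
      refine hsign fun m => ?_
      rw [hφD, coeff_add]
      exact add_nonneg (hs' m) (ht' m)
    · exact key s hsD t htD hp hq hφD
    · exact key t htD s hsD hq hp (by rw [hφD, add_comm])
    · exfalso
      rw [hp.neg_pow, hq.neg_pow, mul_neg, mul_neg, ← neg_add] at hφD
      refine hsign' _ (fun m => ?_) hφD
      rw [coeff_add]
      exact add_nonneg (hs' m) (ht' m)
  · omega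

theorem card_of_dvd {I : Finset σ} {i : σ} {d : ℕ}
    {A : MvPolynomial σ ℝ} (hA : ∀ m ∈ A.support, m.degree = d ∧ m.support ⊆ I)
    (hpos : ∀ m, 0 ≤ coeff m (A * sumVars I)) (hneg : ∃ m, coeff m A < 0)
    (hdvd : ∀ m ∈ A.support, m i ≠ 0)
    (hrec : ∀ e < d, ∀ A' : MvPolynomial σ ℝ,
      (∀ m ∈ A'.support, m.degree = e ∧ m.support ⊆ I) →
      (∀ m, 0 ≤ coeff m (A' * sumVars I)) → (∃ m, coeff m A' < 0) →
      3 * I.card ≤ (A' * sumVars I).support.card + 4) :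
    3 * I.card ≤ (A * sumVars I).support.card + 4 := by
  set R := A.divMonomial (single i 1) with hR
  have hc : ∀ m, coeff m R = coeff (m + single i 1) A := fun m => by
    rw [hR, coeff_divMonomial, add_comm]
  have hsplit : A = X i * R := by
    ext m
    rw [coeff_X_mul', hc]
    by_cases h : m i = 0
    · rw [if_neg (by simpa using h)]
      by_contra hm
      exact hdvd m (mem_support_iff.2 hm) h
    · rw [if_pos (Finsupp.mem_support_iff.2 h), sub_single_add h]
  have hmul : ∀ m, coeff (m + single i 1) (A * sumVars I) = coeff m (R * sumVars I) := fun m => by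
    rw [hsplit, mul_assoc, add_comm, coeff_X_mul]
  have hdeg : ∀ m ∈ R.support, m.degree + 1 = d ∧ m.support ⊆ I := by
    intro m hm
    rw [mem_support_iff, hc, ← mem_support_iff] at hm
    obtain ⟨h1, h2⟩ := hA _ hm
    refine ⟨by rw [← h1, map_add, Finsupp.degree_single], fun x hx => h2 ?_⟩
    rw [Finsupp.mem_support_iff] at hx ⊢
    simp [hx]
  obtain ⟨m, hm⟩ := hneg
  have hm' : coeff (m - single i 1) R < 0 := by
    rwa [hc, sub_single_add (hdvd m (mem_support_iff.2 hm.ne))]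
  have hd := (hdeg _ (mem_support_iff.2 hm'.ne)).1
  refine (hrec (d - 1) (by omega) R (fun w hw => ⟨by have := (hdeg w hw).1; omega, (hdeg w hw).2⟩)
    (fun w => by rw [← hmul]; exact hpos _) ⟨_, hm'⟩).trans (Nat.add_le_add_right ?_ 4)
  refine Finset.card_le_card_of_injOn (fun w => w + single i 1) (fun w hw => ?_)
    (fun v _ w _ h => add_right_cancel h)
  rw [Finset.mem_coe, mem_support_iff] at hw ⊢
  rwa [hmul]

theorem three_mul_card_le (I : Finset σ) (hI : 2 ≤ I.card) (d : ℕ) (A : MvPolynomial σ ℝ)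
    (hA : ∀ m ∈ A.support, m.degree = d ∧ m.support ⊆ I)
    (hpos : ∀ m, 0 ≤ coeff m (A * sumVars I)) (hneg : ∃ m, coeff m A < 0) :
    3 * I.card ≤ (A * sumVars I).support.card + 4 := by
  induction hN : I.card generalizing I d A with
  | zero => omega
  | succ N ihN =>
  rw [← hN]
  induction d using Nat.strong_induction_on generalizing A with
  | _ d ihd =>
  by_cases h2 : I.card = 2
  · have hA0 : A ≠ 0 := by
      rintro rfl
      simp at hneg
    have := card_le_card_support_mul_sumVars hA0 I
    omega
  by_cases hdiv : ∃ i ∈ I, ∀ m ∈ A.support, m i ≠ 0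
  · obtain ⟨i, -, hi⟩ := hdiv
    exact card_of_dvd hA hpos hneg hi ihd
  push Not at hdiv
  by_cases hfacet : ∃ i ∈ I, ∃ m, coeff m A < 0 ∧ m i = 0
  · obtain ⟨i, hi, hm⟩ := hfacet
    have hcard := Finset.card_erase_of_mem hi
    refine card_of_neg_on_facet (by omega) hi hA hpos hm fun A₀ h3 h4 h5 => ?_
    have := ihN (I.erase i) (by omega) d A₀ h3 h4 h5 (by omega)
    omega
  push Not at hfacet
  have hfull : ∀ m, coeff m A < 0 → ∀ i ∈ I, m i ≠ 0 := fun m hm i hi => hfacet i hi m hm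
  by_cases hone : ∃ a ∈ A.support, ∃ p ∈ I, a p = 0 ∧ ∀ j ∈ I, a j = 0 → j = p
  · obtain ⟨a, ha, p, hp, hap, hau⟩ := hone
    exact card_of_facet_term (by omega) hfull hneg hdiv ha hp hap hau
  push Not at hone
  set A' := termsWith (fun m => ∀ i ∈ I, m i ≠ 0) A with hA'
  have hc : ∀ m, coeff m A' = if ∀ i ∈ I, m i ≠ 0 then coeff m A else 0 := coeff_termsWith _ A
  have hA's : ∀ m ∈ A'.support, m ∈ A.support ∧ ∀ i ∈ I, m i ≠ 0 := by
    intro m hm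
    rw [mem_support_iff, hc] at hm
    split_ifs at hm with h
    · exact ⟨mem_support_iff.2 hm, h⟩
    · exact absurd rfl hm
  have heq : ∀ b, coeff b (A' * sumVars I) ≠ 0 →
      coeff b (A' * sumVars I) = coeff b (A * sumVars I) := by
    intro b hb
    have hbi := interior_of_coeff_ne_zero hb
    refine coeff_mul_eq_of_interior hbi fun j hj hjs hbj => ?_
    obtain ⟨i, hi, h3, h4⟩ := hone _ hjs j hj (by simp [hbj])
    apply hbi i hi
    simpa [Finsupp.single_apply, Ne.symm h4] using h3
  obtain ⟨i, hi⟩ : I.Nonempty := Finset.card_pos.1 (by omega)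
  have hfin : 3 * I.card ≤ (A' * sumVars I).support.card + 4 := by
    refine card_of_dvd (fun m hm => hA m (hA's m hm).1) (fun b => ?_) ?_
      (fun m hm => (hA's m hm).2 i hi) ihd
    · by_cases hb : coeff b (A' * sumVars I) = 0
      · exact hb.ge
      · rw [heq b hb]; exact hpos b
    · obtain ⟨m, hm⟩ := hneg
      exact ⟨m, by rwa [hc, if_pos (hfull m hm)]⟩
  refine hfin.trans (Nat.add_le_add_right (Finset.card_le_card fun b hb => ?_) 4)
  rw [mem_support_iff] at hb ⊢
  rwa [← heq b hb]

end LinearForm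

/-- Theorem 1.3(A): if a homogeneous polynomial `A` of degree `d ≥ 2` in `n ≥ 2` variables has
a negative coefficient while `A * (x_1 + ⋯ + x_n)` has nonnegative coefficients, then the
number of monomials of `A * S_n` is at least `3n - 4`. -/
theorem stmt0 (n d : ℕ) (hn : 2 ≤ n) (hd : 2 ≤ d)
    (A : MvPolynomial (Fin n) ℝ) (hA : A.IsHomogeneous d)
    (hneg : ∃ m, coeff m A < 0)
    (S : MvPolynomial (Fin n) ℝ) (hS : S = ∑ i, X i)
    (hpos : ∀ m, 0 ≤ coeff m (A * S)) :
    3 * n - 4 ≤ (A * S).support.card := by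
  have hS' : S = sumVars Finset.univ := hS
  subst hS'
  have := three_mul_card_le Finset.univ (by simpa using hn) d A
    (fun m hm => ⟨by
      have := hA (mem_support_iff.1 hm)
      rwa [Finsupp.degree_eq_weight_one], Finset.subset_univ _⟩) hpos hneg
  rw [Finset.card_univ, Fintype.card_fin] at this
  omega
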